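/- For every p ∈ (0,1), the function E is differentiable at p with derivative E'(p) = E(p)/p − K(p)/p. -/

import Mathlib

/-- Complete elliptic integral of the first kind. -/
noncomputable def ellipticK (p : ℝ) : ℝ :=
  ∫ z in (0:ℝ)..1, 1 / (Real.sqrt (1 - z ^ 2) * Real.sqrt (1 - p ^ 2 * z ^ 2))

/-- Complete elliptic integral of the second kind. -/
noncomputable def ellipticE (p : ℝ) : ℝ :=
  ∫ z in (0:ℝ)..1, Real.sqrt (1 - p ^ 2 * z ^ 2) / Real.sqrt (1 - z ^ 2)

open MeasureTheory Set

theorem intervalIntegrable_inv_sqrt_one_sub_sq :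
    IntervalIntegrable (fun z : ℝ => (Real.sqrt (1 - z ^ 2))⁻¹) volume 0 1 := by
  rw [intervalIntegrable_iff_integrableOn_Ioc_of_le zero_le_one]
  refine intervalIntegral.integrableOn_deriv_of_nonneg (g := Real.arcsin)
    Real.continuous_arcsin.continuousOn (fun x hx => ?_) (fun x _ => by positivity)
  simpa using Real.hasDerivAt_arcsin (by linarith [hx.1]) hx.2.ne

theorem one_sub_sq_mul_sq_ge {x q z : ℝ} (hx : 0 ≤ x) (hxq : x ≤ q) (hz : z ∈ Icc (0 : ℝ) 1) :
    1 - q ^ 2 ≤ 1 - x ^ 2 * z ^ 2 := by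
  have hxz : x * z ≤ q := (mul_le_of_le_one_right hx hz.2).trans hxq
  have := pow_le_pow_left₀ (mul_nonneg hx hz.1) hxz 2
  rw [mul_pow] at this
  linarith

theorem one_sub_sq_mul_sq_pos {x z : ℝ} (hx : 0 ≤ x) (hx1 : x < 1) (hz : z ∈ Icc (0 : ℝ) 1) :
    0 < 1 - x ^ 2 * z ^ 2 :=
  (by nlinarith : 0 < 1 - x ^ 2).trans_le (one_sub_sq_mul_sq_ge hx le_rfl hz)

theorem intervalIntegrable_ellipticE_integrand (p : ℝ) :
    IntervalIntegrable (fun z : ℝ => Real.sqrt (1 - p ^ 2 * z ^ 2) / Real.sqrt (1 - z ^ 2))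
      volume 0 1 := by
  simp only [div_eq_mul_inv]
  exact intervalIntegrable_inv_sqrt_one_sub_sq.continuousOn_mul (by fun_prop)

theorem intervalIntegrable_ellipticK_integrand {p : ℝ} (hp : 0 ≤ p) (hp1 : p < 1) :
    IntervalIntegrable
      (fun z : ℝ => 1 / (Real.sqrt (1 - z ^ 2) * Real.sqrt (1 - p ^ 2 * z ^ 2))) volume 0 1 := by
  simp only [one_div, mul_inv]
  refine intervalIntegrable_inv_sqrt_one_sub_sq.mul_continuousOn
    (ContinuousOn.inv₀ (by fun_prop) fun z hz => ?_)
  rw [uIcc_of_le zero_le_one] at hz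
  exact (Real.sqrt_pos.2 (one_sub_sq_mul_sq_pos hp hp1 hz)).ne'

theorem hasDerivAt_ellipticE_integrand {x z : ℝ} (h : 0 < 1 - x ^ 2 * z ^ 2) :
    HasDerivAt (fun x : ℝ => Real.sqrt (1 - x ^ 2 * z ^ 2) / Real.sqrt (1 - z ^ 2))
      (-(x * z ^ 2) / Real.sqrt (1 - x ^ 2 * z ^ 2) * (Real.sqrt (1 - z ^ 2))⁻¹) x := by
  have hd : HasDerivAt (fun x : ℝ => 1 - x ^ 2 * z ^ 2) (-(2 * x * z ^ 2)) x := by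
    simpa using ((hasDerivAt_pow 2 x).mul_const (z ^ 2)).const_sub 1
  refine ((hd.sqrt h.ne').div_const (Real.sqrt (1 - z ^ 2))).congr_deriv ?_
  have := (Real.sqrt_pos.2 h).ne'
  rw [div_eq_mul_inv _ (Real.sqrt (1 - z ^ 2))]
  congr 1
  field_simp

theorem hasDerivAt_ellipticE {p : ℝ} (hp : 0 < p) (hp1 : p < 1) :
    HasDerivAt ellipticE (ellipticE p / p - ellipticK p / p) p := by
  obtain ⟨q, hpq, hq1⟩ := exists_between hp1
  have hq : 0 < 1 - q ^ 2 := by nlinarith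
  have hmem {z : ℝ} (hz : z ∈ uIoc (0 : ℝ) 1) : z ∈ Icc (0 : ℝ) 1 := by
    rw [uIoc_of_le zero_le_one] at hz
    exact Ioc_subset_Icc_self hz
  have key := (intervalIntegral.hasDerivAt_integral_of_dominated_loc_of_deriv_le
    (μ := volume) (a := 0) (b := 1)
    (F := fun x z : ℝ => Real.sqrt (1 - x ^ 2 * z ^ 2) / Real.sqrt (1 - z ^ 2))
    (F' := fun x z : ℝ =>
      -(x * z ^ 2) / Real.sqrt (1 - x ^ 2 * z ^ 2) * (Real.sqrt (1 - z ^ 2))⁻¹)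
    (bound := fun z : ℝ => 1 / Real.sqrt (1 - q ^ 2) * (Real.sqrt (1 - z ^ 2))⁻¹)
    (Ioo_mem_nhds hp hpq)
    (.of_forall fun x => Measurable.aestronglyMeasurable (by fun_prop))
    (intervalIntegrable_ellipticE_integrand p)
    (Measurable.aestronglyMeasurable (by fun_prop))
    (.of_forall fun z hz x hx => ?_)
    (intervalIntegrable_inv_sqrt_one_sub_sq.const_mul _)
    (.of_forall fun z hz x hx => hasDerivAt_ellipticE_integrand
      (one_sub_sq_mul_sq_pos hx.1.le (hx.2.trans hq1) (hmem hz)))).2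
  · refine key.congr_deriv (Eq.symm ?_)
    rw [ellipticE, ellipticK, ← intervalIntegral.integral_div, ← intervalIntegral.integral_div,
      ← intervalIntegral.integral_sub ((intervalIntegrable_ellipticE_integrand p).div_const p)
        ((intervalIntegrable_ellipticK_integrand hp.le hp1).div_const p)]
    refine intervalIntegral.integral_congr fun z hz => ?_
    rw [uIcc_of_le zero_le_one] at hz
    have hpos := one_sub_sq_mul_sq_pos hp.le hp1 hz
    have hne := (Real.sqrt_pos.2 hpos).ne'
    have hsq := Real.sq_sqrt hpos.le
    simp only [div_eq_mul_inv, mul_inv, one_mul]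
    generalize (Real.sqrt (1 - z ^ 2))⁻¹ = w
    field_simp
    rw [hsq]
    ring
  · have hz' := hmem hz
    have hle := one_sub_sq_mul_sq_ge hx.1.le hx.2.le hz'
    have hsqrt := Real.sqrt_pos.2 hq
    have hxz : x * z ^ 2 ≤ 1 :=
      mul_le_one₀ (hx.2.trans hq1).le (sq_nonneg z) (pow_le_one₀ hz'.1 hz'.2)
    have hxz0 : 0 ≤ x * z ^ 2 := mul_nonneg hx.1.le (sq_nonneg z)
    rw [norm_mul, norm_div, norm_neg, Real.norm_of_nonneg hxz0,
      Real.norm_of_nonneg (Real.sqrt_nonneg _),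
      Real.norm_of_nonneg (inv_nonneg.2 (Real.sqrt_nonneg _))]
    gcongr
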